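/- Let n ≥ 1, let 0 ≤ ρ < 1 and 0 ≤ ρ' ≤ ρ/2 with ρ + ρ' < 1, let K ⊂ ℝⁿ × ℝⁿ be compact, and for each pair of multi-indices (α, β) let C_{αβ} > 0 be given. Then there exists a constant C > 0 such that the following holds. Let h ∈ (0,1] and let a : ℝⁿ × ℝⁿ → ℂ (in variables (y,η)) be a smooth function supported in K satisfying sup |∂_y^{α} ∂_η^{β} a| ≤ C_{αβ} h^{−ρ|α| − ρ'|β|} for all multi-indices (α, β), and such that Re a(y,η) ≥ 0 for all (y,η). Define the standard quantization of a on Schwartz functions u by (Op_h(a) u)(y) = (2πh)^{−n} ∫∫ e^{i(y−y')·η/h} a(y,η) u(y') dy' dη. Then for every Schwartz function u on ℝⁿ: Re ⟨Op_h(a) u, u⟩_{L²(ℝⁿ)} ≥ −C h^{1−ρ−ρ'} ‖u‖²_{L²(ℝⁿ)}. -/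

import Mathlib

open MeasureTheory

/-- The partial derivative of `f : ℝⁿ × ℝⁿ → ℂ` in the `i`-th coordinate direction:
`Sum.inl j` is the `j`-th direction in the first (`y`) group of variables and
`Sum.inr j` the `j`-th direction in the second (`η`) group. -/
noncomputable def pderiv1 {n : ℕ} (i : Fin n ⊕ Fin n)
    (f : ((Fin n → ℝ) × (Fin n → ℝ)) → ℂ) :
    ((Fin n → ℝ) × (Fin n → ℝ)) → ℂ := fun p =>
  fderiv ℝ f p
    (Sum.elim (fun j => (Pi.single j 1, 0)) (fun j => (0, Pi.single j 1)) i)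

/-- Iterated partial derivatives `∂_y^α ∂_η^β` along the list of coordinate
directions `l` (multi-indices are encoded as lists of directions; the number of
`y`-derivatives is `l.countP Sum.isLeft` and the number of `η`-derivatives is
`l.countP Sum.isRight`). -/
noncomputable def pderivs {n : ℕ} (l : List (Fin n ⊕ Fin n))
    (f : ((Fin n → ℝ) × (Fin n → ℝ)) → ℂ) :
    ((Fin n → ℝ) × (Fin n → ℝ)) → ℂ :=
  l.foldr pderiv1 f

/-- The standard quantization `Op_h(a) u (y) = (2πh)^{-n} ∫∫ e^{i(y-y')·η/h} a(y,η) u(y')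
dy' dη` of a symbol `a` on `T*ℝⁿ`, applied to a function `u`. -/
noncomputable def stdOp {n : ℕ} (h : ℝ) (a : ((Fin n → ℝ) × (Fin n → ℝ)) → ℂ)
    (u : (Fin n → ℝ) → ℂ) : (Fin n → ℝ) → ℂ := fun y =>
  ((2 * Real.pi * h) ^ n)⁻¹ •
    ∫ η : Fin n → ℝ, ∫ y' : Fin n → ℝ,
      Complex.exp (Complex.I * ((∑ i, (y i - y' i) * η i : ℝ) : ℂ) / (h : ℂ)) *
        a (y, η) * u y'

namespace GardingModel

open scoped FourierTransform SchwartzMap ComplexConjugate InnerProductSpace ContDiff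

/-- The character `t ↦ e^{2πit}`. -/
noncomputable def phase (t : ℝ) : ℂ := Complex.exp ((2 * Real.pi * t : ℝ) * Complex.I)

lemma phase_add (s t : ℝ) : phase (s + t) = phase s * phase t := by
  rw [phase, phase, phase, ← Complex.exp_add]
  congr 1
  push_cast
  ring

@[simp] lemma phase_zero : phase 0 = 1 := by simp [phase]

@[simp] lemma norm_phase (t : ℝ) : ‖phase t‖ = 1 := Complex.norm_exp_ofReal_mul_I _

@[simp] lemma conj_phase (t : ℝ) : conj (phase t) = phase (-t) := by
  rw [phase, phase, ← Complex.exp_conj]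
  simp only [map_mul, Complex.conj_ofReal, Complex.conj_I]
  push_cast
  congr 1
  ring

@[fun_prop] lemma continuous_phase : Continuous phase := by
  unfold phase
  fun_prop

section PhaseSpace

variable {V : Type*} [NormedAddCommGroup V]

/-- The Gaussian `e^{-π|x|²}`. -/
noncomputable def gauss (x : V) : ℝ := Real.exp (-(Real.pi * ‖x‖ ^ 2))

lemma gauss_neg (x : V) : gauss (-x) = gauss x := by simp [gauss]

lemma gauss_sub_comm (x y : V) : gauss (x - y) = gauss (y - x) := by
  rw [← gauss_neg, neg_sub]

lemma gauss_pos (x : V) : 0 < gauss x := Real.exp_pos _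

lemma gauss_le_one (x : V) : gauss x ≤ 1 := by
  rw [gauss, Real.exp_le_one_iff, Left.neg_nonpos_iff]
  positivity

@[fun_prop] lemma continuous_gauss : Continuous (gauss : V → ℝ) := by
  unfold gauss
  fun_prop

lemma norm_iteratedFDeriv_translate_sub_le [NormedSpace ℝ V] {f : V → ℂ} (hf : ContDiff ℝ ∞ f)
    {k : ℕ} {M : ℝ} (h : ∀ z, ‖iteratedFDeriv ℝ (k + 1) f z‖ ≤ M) (w z : V) :
    ‖iteratedFDeriv ℝ k (fun z => f (z + w) - f z) z‖ ≤ M * ‖w‖ := by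
  have hk : ContDiffAt ℝ k f z := (hf.of_le (mod_cast le_top)).contDiffAt
  have hkw : ContDiffAt ℝ k (fun z => f (z + w)) z :=
    ((hf.comp (contDiff_id.add contDiff_const)).of_le (mod_cast le_top)).contDiffAt
  rw [show (fun z => f (z + w) - f z) = (fun z => f (z + w)) - f from rfl,
    iteratedFDeriv_sub_apply hkw hk, iteratedFDeriv_comp_add_right]
  have := Convex.norm_image_sub_le_of_norm_fderiv_le (𝕜 := ℝ) (s := Set.univ)
    (f := iteratedFDeriv ℝ k f) (C := M) (x := z) (y := z + w)
    (fun x _ => hf.differentiable_iteratedFDeriv (mod_cast WithTop.coe_lt_top _) x)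
    (fun x _ => by rw [norm_fderiv_iteratedFDeriv]; exact h x) convex_univ
    (Set.mem_univ _) (Set.mem_univ _)
  simpa using this

variable [InnerProductSpace ℝ V]

lemma hasTemperateGrowth_gauss : (gauss : V → ℝ).HasTemperateGrowth := by
  have hu : UniqueDiffOn ℝ (Set.Iic (0 : ℝ)) := uniqueDiffOn_Iic 0
  have hf : (fun x : V => -(Real.pi * ‖x‖ ^ 2)).HasTemperateGrowth :=
    ((Function.HasTemperateGrowth.const Real.pi).mul
      (Function.hasTemperateGrowth_norm_sq V)).neg
  refine Function.HasTemperateGrowth.comp' (g := Real.exp) (t := Set.Iic 0) ?_ hu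
    Real.contDiff_exp.contDiffOn (fun N => ⟨0, 1, zero_le_one, fun n _ x hx => ?_⟩) hf
  · rintro _ ⟨x, rfl⟩
    simp only [Set.mem_Iic, Left.neg_nonpos_iff]
    positivity
  · rw [iteratedFDerivWithin_eq_iteratedFDeriv hu Real.contDiff_exp.contDiffAt hx,
      norm_iteratedFDeriv_eq_norm_iteratedDeriv, iteratedDeriv_eq_iterate, Real.iter_deriv_exp]
    simpa using hx

/-- The Kohn–Nirenberg symbol of the projection onto the standard Gaussian. -/
noncomputable def gaussSymbol (z : V × V) : ℂ :=
  gauss z.1 * gauss z.2 * phase (-⟪z.1, z.2⟫_ℝ)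

lemma gaussSymbol_neg (z : V × V) : gaussSymbol (-z) = gaussSymbol z := by
  simp [gaussSymbol, gauss_neg]

@[fun_prop] lemma continuous_gaussSymbol : Continuous (gaussSymbol : V × V → ℂ) := by
  unfold gaussSymbol
  fun_prop

lemma norm_gaussSymbol (z : V × V) : ‖gaussSymbol z‖ = gauss z.1 * gauss z.2 := by
  simp [gaussSymbol, abs_of_pos (gauss_pos _)]

lemma norm_gaussSymbol_le_one (z : V × V) : ‖gaussSymbol z‖ ≤ 1 := by
  rw [norm_gaussSymbol]
  exact mul_le_one₀ (gauss_le_one _) (gauss_pos _).le (gauss_le_one _)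

variable [FiniteDimensional ℝ V] [MeasurableSpace V] [BorelSpace V]

lemma integral_gauss_mul_phase (x : V) :
    ∫ η : V, (gauss η : ℂ) * phase ⟪x, η⟫_ℝ = gauss x := by
  have h := fourier_gaussian_innerProductSpace (V := V) (b := (Real.pi : ℂ))
    (by simpa using Real.pi_pos) (-x)
  rw [Real.fourier_eq'] at h
  have hpi : (Real.pi : ℂ) ≠ 0 := by simp [Real.pi_ne_zero]
  rw [div_self hpi, Complex.one_cpow, one_mul, norm_neg] at h
  convert h using 1
  · refine integral_congr_ae (Filter.Eventually.of_forall fun η => ?_)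
    simp only [phase, gauss, smul_eq_mul, inner_neg_right, real_inner_comm η x]
    rw [mul_comm]
    push_cast
    congr 2 <;> ring
  · rw [gauss]
    push_cast
    congr 1
    field_simp

lemma integrable_gauss : Integrable (gauss : V → ℝ) := by
  have h := (GaussianFourier.integrable_cexp_neg_mul_sq_norm_add (V := V) (b := (Real.pi : ℂ))
    (by simpa using Real.pi_pos) 0 0).norm
  refine h.congr (Filter.Eventually.of_forall fun η => ?_)
  simp only [gauss, Complex.norm_exp]
  norm_cast
  simp

lemma fourier_eq_phase (f : V → ℂ) (w : V) :
    𝓕 f w = ∫ v, f v * phase (-⟪v, w⟫_ℝ) := by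
  rw [Real.fourier_eq']
  refine integral_congr_ae (Filter.Eventually.of_forall fun v => ?_)
  simp only [phase, smul_eq_mul]
  rw [mul_comm]
  congr 4
  ring

/-- The short-time Fourier transform with Gaussian window. -/
noncomputable def stft (u : V → ℂ) (x ξ : V) : ℂ :=
  ∫ y, u y * gauss (x - y) * phase (-⟪y, ξ⟫_ℝ)

/-- The Rihaczek distribution of `u`, against which a symbol is integrated to obtain the
quadratic form of its standard quantization. -/
noncomputable def rihaczek (u : V → ℂ) (z : V × V) : ℂ :=
  conj (u z.1) * 𝓕 u z.2 * phase ⟪z.1, z.2⟫_ℝ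

lemma integrable_gaussSymbol : Integrable (gaussSymbol : V × V → ℂ) := by
  refine (Integrable.mul_prod (integrable_gauss (V := V)) (integrable_gauss (V := V))).mono'
    continuous_gaussSymbol.aestronglyMeasurable (Filter.Eventually.of_forall fun z => ?_)
  rw [norm_gaussSymbol]

lemma continuous_fourier (u : 𝓢(V, ℂ)) : Continuous (𝓕 (u : V → ℂ)) := by
  rw [← SchwartzMap.fourier_coe]
  exact (𝓕 u).continuous

@[fun_prop] lemma continuous_rihaczek (u : 𝓢(V, ℂ)) : Continuous (rihaczek u) := by
  have h1 := continuous_fourier u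
  have h2 := u.continuous
  unfold rihaczek
  fun_prop

lemma exists_norm_rihaczek_le (u : 𝓢(V, ℂ)) : ∃ c, ∀ z, ‖rihaczek u z‖ ≤ c := by
  refine ⟨SchwartzMap.seminorm ℝ 0 0 u * SchwartzMap.seminorm ℝ 0 0 (𝓕 u), fun z => ?_⟩
  simp only [rihaczek, norm_mul, norm_phase, mul_one, RCLike.norm_conj]
  exact mul_le_mul (SchwartzMap.norm_le_seminorm ℝ u _)
    (SchwartzMap.norm_le_seminorm ℝ (𝓕 u) _) (norm_nonneg _) (apply_nonneg _ _)

lemma integral_fourier_mul_gauss (u : 𝓢(V, ℂ)) (x ξ : V) :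
    ∫ η, 𝓕 (u : V → ℂ) η * gauss (η - ξ) * phase ⟪x, η⟫_ℝ = phase ⟪x, ξ⟫_ℝ * stft u x ξ := by
  have hint : Integrable (Function.uncurry fun η y : V =>
      ((gauss (η - ξ) : ℝ) : ℂ) * u y * phase (⟪x, η⟫_ℝ - ⟪y, η⟫_ℝ)) (volume.prod volume) := by
    have hu : Integrable u := u.integrable
    have hg : Integrable fun η : V => ((gauss (η - ξ) : ℝ) : ℂ) :=
      (integrable_gauss.comp_sub_right ξ).ofReal
    refine (Integrable.mul_prod hg hu).mul_of_top_left (memLp_top_of_bound ?_ 1 ?_)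
    · exact (Continuous.aestronglyMeasurable (by fun_prop))
    · exact Filter.Eventually.of_forall fun z => by simp
  calc _ = ∫ η, ∫ y, ((gauss (η - ξ) : ℝ) : ℂ) * u y * phase (⟪x, η⟫_ℝ - ⟪y, η⟫_ℝ) := by
        refine integral_congr_ae (Filter.Eventually.of_forall fun η => ?_)
        simp only [fourier_eq_phase]
        rw [mul_assoc, mul_comm, ← integral_const_mul]
        refine integral_congr_ae (Filter.Eventually.of_forall fun y => ?_)
        simp only [sub_eq_add_neg, phase_add]
        ring
    _ = ∫ y, ∫ η, ((gauss (η - ξ) : ℝ) : ℂ) * u y * phase (⟪x, η⟫_ℝ - ⟪y, η⟫_ℝ) :=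
        integral_integral_swap hint
    _ = ∫ y, phase ⟪x, ξ⟫_ℝ * (u y * gauss (x - y) * phase (-⟪y, ξ⟫_ℝ)) := by
        refine integral_congr_ae (Filter.Eventually.of_forall fun y => ?_)
        simp only
        rw [← integral_gauss_mul_phase (x - y),
          ← integral_add_right_eq_self _ ξ, mul_comm (u y), ← integral_mul_const,
          ← integral_mul_const, ← integral_const_mul]
        refine integral_congr_ae (Filter.Eventually.of_forall fun η => ?_)
        simp only [add_sub_cancel_right]
        simp only [inner_add_right, inner_add_left, inner_neg_left, sub_eq_add_neg, neg_add,
          phase_add]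
        ring
    _ = _ := by rw [integral_const_mul, stft]

lemma integral_rihaczek_mul_gaussSymbol (u : 𝓢(V, ℂ)) (w ζ : V × V) :
    ∫ z, rihaczek u z * gaussSymbol (z - w) * phase (⟪ζ.1, z.1⟫_ℝ + ⟪ζ.2, z.2⟫_ℝ) =
      phase ⟪ζ.2, w.2⟫_ℝ * conj (stft u w.1 (w.2 + ζ.1)) * stft u (w.1 + ζ.2) w.2 := by
  have h1 : ∫ y, conj (u y) * gauss (y - w.1) * phase ⟪y, w.2 + ζ.1⟫_ℝ =
      conj (stft u w.1 (w.2 + ζ.1)) := by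
    rw [stft, ← integral_conj]
    refine integral_congr_ae (Filter.Eventually.of_forall fun y => ?_)
    simp [gauss_sub_comm y]
  have h2 := integral_fourier_mul_gauss u (w.1 + ζ.2) w.2
  calc _ = ∫ z : V × V, phase (-⟪w.1, w.2⟫_ℝ) *
        ((conj (u z.1) * gauss (z.1 - w.1) * phase ⟪z.1, w.2 + ζ.1⟫_ℝ) *
          (𝓕 (u : V → ℂ) z.2 * gauss (z.2 - w.2) * phase ⟪w.1 + ζ.2, z.2⟫_ℝ)) := by
        refine integral_congr_ae (Filter.Eventually.of_forall fun z => ?_)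
        simp only [rihaczek, gaussSymbol, Prod.fst_sub, Prod.snd_sub]
        have : phase ⟪z.1, z.2⟫_ℝ * phase (-⟪z.1 - w.1, z.2 - w.2⟫_ℝ) *
            phase (⟪ζ.1, z.1⟫_ℝ + ⟪ζ.2, z.2⟫_ℝ) =
            phase (-⟪w.1, w.2⟫_ℝ) * phase ⟪z.1, w.2 + ζ.1⟫_ℝ * phase ⟪w.1 + ζ.2, z.2⟫_ℝ := by
          simp only [← phase_add, inner_add_left, inner_add_right, inner_sub_left,
            inner_sub_right, real_inner_comm z.1 ζ.1]
          congr 1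
          ring
        linear_combination (conj (u z.1) * 𝓕 (u : V → ℂ) z.2 * gauss (z.1 - w.1) *
          gauss (z.2 - w.2)) * this
    _ = _ := by
        rw [integral_const_mul, Measure.volume_eq_prod, integral_prod_mul
          (fun y : V => conj (u y) * gauss (y - w.1) * phase ⟪y, w.2 + ζ.1⟫_ℝ)
          (fun η : V => 𝓕 (u : V → ℂ) η * gauss (η - w.2) * phase ⟪w.1 + ζ.2, η⟫_ℝ), h1, h2]
        have : phase (-⟪w.1, w.2⟫_ℝ) * phase ⟪w.1 + ζ.2, w.2⟫_ℝ = phase ⟪ζ.2, w.2⟫_ℝ := by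
          rw [← phase_add, inner_add_left]
          congr 1
          ring
        linear_combination (conj (stft u w.1 (w.2 + ζ.1)) * stft u (w.1 + ζ.2) w.2) * this

lemma integral_gauss : ∫ x : V, gauss x = 1 := by
  have h := integral_gauss_mul_phase (0 : V)
  simp only [inner_zero_left, phase_zero, mul_one, integral_complex_ofReal] at h
  have h' : ((∫ x : V, gauss x : ℝ) : ℂ) = ((gauss (0 : V) : ℝ) : ℂ) := h
  rw [Complex.ofReal_inj.1 h', gauss]
  simp

lemma continuous_stft (u : 𝓢(V, ℂ)) : Continuous fun z : V × V => stft u z.1 z.2 := by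
  have hu := u.continuous
  unfold stft
  refine continuous_of_dominated (bound := fun y => ‖u y‖) (fun z => ?_) (fun z => ?_)
    u.integrable.norm ?_
  · exact Continuous.aestronglyMeasurable (by fun_prop)
  · refine Filter.Eventually.of_forall fun y => ?_
    rw [norm_mul, norm_mul, norm_phase, mul_one, Complex.norm_real, Real.norm_eq_abs,
      abs_of_pos (gauss_pos _)]
    exact mul_le_of_le_one_right (norm_nonneg _) (gauss_le_one _)
  · exact Filter.Eventually.of_forall fun y => by fun_prop

lemma integral_norm_sq_stft (u : 𝓢(V, ℂ)) (x : V) :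
    ∫⁻ ξ, ‖stft u x ξ‖ₑ ^ 2 = ∫⁻ y, ‖u y‖ₑ ^ 2 * ENNReal.ofReal (gauss (x - y) ^ 2) := by
  have hg : (fun y : V => gauss (x - y)).HasTemperateGrowth :=
    hasTemperateGrowth_gauss.comp
      ((Function.HasTemperateGrowth.const x).sub Function.HasTemperateGrowth.id')
  let f : 𝓢(V, ℂ) := SchwartzMap.smulLeftCLM ℂ (fun y : V => gauss (x - y)) u
  have hf : ∀ y, f y = u y * gauss (x - y) := fun y => by
    rw [SchwartzMap.smulLeftCLM_apply_apply hg, Complex.real_smul, mul_comm]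
  have h1 : ∀ ξ, stft u x ξ = 𝓕 f ξ := fun ξ => by
    rw [SchwartzMap.fourier_coe, fourier_eq_phase, stft]
    simp_rw [hf]
  have key : ∀ g : 𝓢(V, ℂ), ∫⁻ ξ, ‖g ξ‖ₑ ^ 2 = ENNReal.ofReal (∫ ξ, ‖g ξ‖ ^ 2) := fun g => by
    have hg2 : Integrable fun ξ => ‖g ξ‖ ^ 2 := (g.memLp 2).integrable_norm_pow (by simp)
    rw [ofReal_integral_eq_lintegral_ofReal hg2
      (Filter.Eventually.of_forall fun ξ => by positivity)]
    refine lintegral_congr fun ξ => ?_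
    rw [ENNReal.ofReal_pow (norm_nonneg _), ofReal_norm]
  calc _ = ∫⁻ ξ, ‖𝓕 f ξ‖ₑ ^ 2 := by simp_rw [h1]
    _ = ∫⁻ ξ, ‖f ξ‖ₑ ^ 2 := by rw [key, key, SchwartzMap.integral_norm_sq_fourier]
    _ = _ := by
      refine lintegral_congr fun y => ?_
      rw [hf, enorm_mul, mul_pow, ENNReal.ofReal_pow (gauss_pos _).le, ← ofReal_norm
        ((gauss (x - y) : ℝ) : ℂ), Complex.norm_real, Real.norm_eq_abs, abs_of_pos (gauss_pos _)]

lemma lintegral_norm_sq_stft_le (u : 𝓢(V, ℂ)) :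
    ∫⁻ z : V × V, ‖stft u z.1 z.2‖ₑ ^ 2 ≤ ENNReal.ofReal (∫ y, ‖u y‖ ^ 2) := by
  have hc := continuous_stft u
  have hu := u.continuous
  have hu2 : Integrable fun ξ => ‖u ξ‖ ^ 2 := (u.memLp 2).integrable_norm_pow (by simp)
  have hle : ∀ y : V, ∫⁻ x, ENNReal.ofReal (gauss (x - y) ^ 2) ≤ 1 := fun y => by
    calc _ ≤ ∫⁻ x, ENNReal.ofReal (gauss (x - y)) := by
          refine lintegral_mono fun x => ENNReal.ofReal_le_ofReal ?_
          exact pow_le_of_le_one (gauss_pos _).le (gauss_le_one _) two_ne_zero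
      _ = ENNReal.ofReal (∫ x, gauss (x - y)) :=
          (ofReal_integral_eq_lintegral_ofReal (integrable_gauss.comp_sub_right y)
            (Filter.Eventually.of_forall fun x => (gauss_pos _).le)).symm
      _ = 1 := by rw [integral_sub_right_eq_self (fun x => gauss x), integral_gauss]; simp
  calc _ = ∫⁻ x, ∫⁻ ξ, ‖stft u x ξ‖ₑ ^ 2 := by
        rw [Measure.volume_eq_prod, lintegral_prod]
        exact (by fun_prop : Continuous fun z : V × V => ‖stft u z.1 z.2‖ₑ ^ 2).aemeasurable
    _ = ∫⁻ y, ∫⁻ x, ‖u y‖ₑ ^ 2 * ENNReal.ofReal (gauss (x - y) ^ 2) := by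
        simp_rw [integral_norm_sq_stft]
        refine lintegral_lintegral_swap (Measurable.aemeasurable ?_)
        have h1 : Measurable fun z : V × V => ‖u z.2‖ₑ ^ 2 :=
          (by fun_prop : Continuous fun z : V × V => ‖u z.2‖ₑ ^ 2).measurable
        have h2 : Measurable fun z : V × V => ENNReal.ofReal (gauss (z.1 - z.2) ^ 2) :=
          (by fun_prop : Continuous fun z : V × V => gauss (z.1 - z.2) ^ 2).measurable.ennreal_ofReal
        exact h1.mul h2
    _ ≤ ∫⁻ y, ‖u y‖ₑ ^ 2 := by
        refine lintegral_mono fun y => ?_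
        rw [lintegral_const_mul]
        · exact mul_le_of_le_one_right zero_le (hle y)
        · exact (by fun_prop : Continuous fun x : V => gauss (x - y) ^ 2).measurable.ennreal_ofReal
    _ = _ := by
        rw [ofReal_integral_eq_lintegral_ofReal hu2
          (Filter.Eventually.of_forall fun ξ => by positivity)]
        refine lintegral_congr fun ξ => ?_
        rw [ENNReal.ofReal_pow (norm_nonneg _), ofReal_norm]

/-- Smooth compactly supported functions on `V × V` are superpositions of plane waves, with
amplitude controlled by finitely many `L¹` norms of derivatives. -/
lemma exists_planeWave_decomposition :
    ∃ N : ℕ, ∃ κ : V × V → ℝ, Integrable κ ∧ Continuous κ ∧ (∀ ζ, 0 ≤ κ ζ) ∧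
      ∀ b : V × V → ℂ, ContDiff ℝ ∞ b → HasCompactSupport b → ∀ M : ℝ,
        (∀ q ≤ N, ∫ z, ‖iteratedFDeriv ℝ q b z‖ ≤ M) →
        ∃ k : V × V → ℂ, Continuous k ∧ (∀ ζ, ‖k ζ‖ ≤ M * κ ζ) ∧
          ∀ z, b z = ∫ ζ, k ζ * phase (⟪ζ.1, z.1⟫_ℝ + ⟪ζ.2, z.2⟫_ℝ) := by
  let L : WithLp 2 (V × V) ≃L[ℝ] V × V := WithLp.prodContinuousLinearEquiv 2 ℝ V V
  let N := Module.finrank ℝ (WithLp 2 (V × V)) + 1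
  let c : ℝ := 2 ^ N * (2 * (2 ^ N * (N + 1))) * (1 + ‖(L : WithLp 2 (V × V) →L[ℝ] V × V)‖) ^ N
  have hcpos : 0 ≤ c := by positivity
  have hmp : MeasurePreserving (WithLp.toLp 2 : V × V → WithLp 2 (V × V)) :=
    WithLp.volume_preserving_toLp V V
  have hme : MeasurableEmbedding (WithLp.toLp 2 : V × V → WithLp 2 (V × V)) :=
    L.symm.toHomeomorph.measurableEmbedding
  have hint : Integrable fun w : WithLp 2 (V × V) => (1 + ‖w‖) ^ (-(N : ℝ)) :=
    integrable_one_add_norm (by simp [N])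
  refine ⟨N, fun ζ => c * (1 + ‖L.symm ζ‖) ^ (-(N : ℝ)), ?_, ?_, ?_, ?_⟩
  · exact ((hmp.integrable_comp_emb hme).2 hint).const_mul c
  · refine continuous_const.mul (Continuous.rpow_const (by fun_prop) fun ζ => Or.inl ?_)
    positivity
  · intro ζ
    positivity
  intro b hb hbc M hM
  have hfs : ContDiff ℝ ∞ (b ∘ L) := hb.comp L.contDiff
  have hfc : HasCompactSupport (b ∘ L) := hbc.comp_homeomorph L.toHomeomorph
  let f : 𝓢(WithLp 2 (V × V), ℂ) := hfc.toSchwartzMap hfs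
  have hf : ∀ w, f w = b (L w) := fun w => rfl
  have hD : ∀ q ≤ N, ∫ w, ‖iteratedFDeriv ℝ q f w‖ ≤
      (1 + ‖(L : WithLp 2 (V × V) →L[ℝ] V × V)‖) ^ N * M := by
    intro q hq
    have hbi : Integrable fun z => ‖iteratedFDeriv ℝ q b z‖ :=
      ((hb.continuous_iteratedFDeriv (mod_cast le_top)).integrable_of_hasCompactSupport
        (hbc.iteratedFDeriv q)).norm
    calc ∫ w, ‖iteratedFDeriv ℝ q f w‖ ≤
        ∫ w, (1 + ‖(L : WithLp 2 (V × V) →L[ℝ] V × V)‖) ^ N * ‖iteratedFDeriv ℝ q b (L w)‖ := by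
          refine integral_mono_of_nonneg (Filter.Eventually.of_forall fun w => norm_nonneg _) ?_
            (Filter.Eventually.of_forall fun w => ?_)
          · refine Integrable.const_mul ?_ _
            exact (hmp.symm (e := L.symm.toHomeomorph.toMeasurableEquiv)
              ).integrable_comp_emb L.toHomeomorph.measurableEmbedding |>.2 hbi
          · change ‖iteratedFDeriv ℝ q (b ∘ (L : WithLp 2 (V × V) →L[ℝ] V × V)) w‖ ≤ _
            rw [ContinuousLinearMap.iteratedFDeriv_comp_right _ hb _ (mod_cast le_top)]
            refine (ContinuousMultilinearMap.norm_compContinuousLinearMap_le _ _).trans ?_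
            simp only [Finset.prod_const, Finset.card_univ, Fintype.card_fin]
            rw [mul_comm]
            gcongr
            · have h0 := norm_nonneg (L : WithLp 2 (V × V) →L[ℝ] V × V)
              exact (pow_le_pow_left₀ h0 (by linarith) q).trans
                (pow_le_pow_right₀ (by linarith) hq)
            · exact le_rfl
      _ = (1 + ‖(L : WithLp 2 (V × V) →L[ℝ] V × V)‖) ^ N * ∫ z, ‖iteratedFDeriv ℝ q b z‖ := by
          rw [integral_const_mul, ← hmp.integral_comp hme]
          rfl
      _ ≤ _ := by
          gcongr
          exact hM q hq
  have hM0 : 0 ≤ M := (integral_nonneg fun z => norm_nonneg _).trans (hM 0 (Nat.zero_le _))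
  have hdecay : ∀ n ≤ N, ∀ w, ‖w‖ ^ n * ‖𝓕 (f : WithLp 2 (V × V) → ℂ) w‖ ≤
      2 ^ N * ((N + 1) * ((1 + ‖(L : WithLp 2 (V × V) →L[ℝ] V × V)‖) ^ N * M)) := by
    intro n hn w
    have h := Real.pow_mul_norm_iteratedFDeriv_fourier_le (V := WithLp 2 (V × V)) (E := ℂ)
      (f := f) (K := ⊤) (N := ⊤) (k := 0) (n := n) f.smooth'
      (fun k n _ _ => f.integrable_pow_mul_iteratedFDeriv volume k n) (by simp)
      (by exact_mod_cast le_top) w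
    simp only [norm_iteratedFDeriv_zero, pow_zero, one_mul, Nat.cast_zero, mul_zero, zero_add] at h
    refine h.trans ?_
    have h2 : (2 : ℝ) ^ n ≤ 2 ^ N := pow_le_pow_right₀ one_le_two hn
    refine mul_le_mul h2 ?_ (Finset.sum_nonneg fun p _ => integral_nonneg fun v => by positivity)
      (by positivity)
    calc _ ≤ ∑ p ∈ Finset.range 1 ×ˢ Finset.range (n + 1),
          ((1 + ‖(L : WithLp 2 (V × V) →L[ℝ] V × V)‖) ^ N * M) := by
          refine Finset.sum_le_sum fun p hp => ?_
          simp only [Finset.mem_product, Finset.mem_range, Nat.lt_one_iff] at hp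
          simp only [hp.1, pow_zero, one_mul]
          exact hD _ (by omega)
      _ ≤ _ := by
          simp only [Finset.sum_const, Finset.card_product, Finset.card_range, one_mul,
            nsmul_eq_mul]
          gcongr
          exact_mod_cast Nat.succ_le_succ hn
  have hF : ∀ w, ‖𝓕 (f : WithLp 2 (V × V) → ℂ) w‖ ≤ M * (c * (1 + ‖w‖) ^ (-(N : ℝ))) := by
    intro w
    have h0 := hdecay 0 (Nat.zero_le _) w
    have hN := hdecay N le_rfl w
    rw [pow_zero, one_mul] at h0
    have hadd : (1 + ‖w‖) ^ N ≤ 2 ^ N * (1 + ‖w‖ ^ N) := by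
      have := add_pow_le (zero_le_one (α := ℝ)) (norm_nonneg w) N
      rw [one_pow] at this
      refine this.trans ?_
      gcongr
      · exact one_le_two
      · omega
    rw [Real.rpow_neg (by positivity), Real.rpow_natCast, ← mul_assoc, ← div_eq_mul_inv,
      le_div_iff₀ (by positivity)]
    calc _ ≤ ‖𝓕 (f : WithLp 2 (V × V) → ℂ) w‖ * (2 ^ N * (1 + ‖w‖ ^ N)) := by gcongr
      _ = 2 ^ N * (‖𝓕 (f : WithLp 2 (V × V) → ℂ) w‖ +
          ‖w‖ ^ N * ‖𝓕 (f : WithLp 2 (V × V) → ℂ) w‖) := by ring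
      _ ≤ 2 ^ N * (2 ^ N * ((N + 1) * ((1 + ‖(L : WithLp 2 (V × V) →L[ℝ] V × V)‖) ^ N * M)) +
          2 ^ N * ((N + 1) * ((1 + ‖(L : WithLp 2 (V × V) →L[ℝ] V × V)‖) ^ N * M))) := by
          gcongr
      _ = M * c := by
          simp only [c]
          ring
  refine ⟨fun ζ => 𝓕 (f : WithLp 2 (V × V) → ℂ) (L.symm ζ), ?_, fun ζ => hF _, fun z => ?_⟩
  · exact (continuous_fourier f).comp L.symm.continuous
  · have hinv := congrFun (f.continuous.fourierInv_fourier_eq f.integrable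
      (by rw [← SchwartzMap.fourier_coe]; exact (𝓕 f).integrable)) (L.symm z)
    rw [hf, L.apply_symm_apply, Real.fourierInv_eq', ← hmp.integral_comp hme] at hinv
    rw [← hinv]
    refine integral_congr_ae (Filter.Eventually.of_forall fun ζ => ?_)
    simp only [smul_eq_mul]
    rw [mul_comm]
    rfl

instance isAddHaarMeasure_volume_prod : (volume : Measure (V × V)).IsAddHaarMeasure :=
  inferInstanceAs ((volume : Measure V).prod (volume : Measure V)).IsAddHaarMeasure

lemma integrable_rihaczek (u : 𝓢(V, ℂ)) : Integrable (rihaczek u) := by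
  have h1 : Integrable fun y => conj (u y) :=
    (LinearIsometryEquiv.integrable_comp_iff Complex.conjLIE).2 u.integrable
  have h2 : Integrable (𝓕 (u : V → ℂ)) := by
    rw [← SchwartzMap.fourier_coe]
    exact (𝓕 u).integrable
  refine (h1.mul_prod h2).mono (continuous_rihaczek u).aestronglyMeasurable
    (Filter.Eventually.of_forall fun z => ?_)
  simp [rihaczek]

lemma exists_cutoff : ∃ m : V × V → ℂ, ContDiff ℝ ∞ m ∧ HasCompactSupport m ∧
    ∫ z, gaussSymbol z * m z ≠ 0 := by
  by_contra! H
  have h := ae_eq_zero_of_integral_contDiff_smul_eq_zero (f := (gaussSymbol : V × V → ℂ))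
    (μ := volume) integrable_gaussSymbol.locallyIntegrable fun g hg hgc => by
      have := H (fun z => (g z : ℂ)) (Complex.ofRealCLM.contDiff.comp hg)
        (hgc.comp_left (g := ((↑) : ℝ → ℂ)) Complex.ofReal_zero)
      rw [← this]
      refine integral_congr_ae (Filter.Eventually.of_forall fun z => ?_)
      simp only [Complex.real_smul]
      ring
  obtain ⟨z, hz⟩ := h.exists
  have := norm_gaussSymbol z
  rw [hz, norm_zero] at this
  exact (mul_pos (gauss_pos z.1) (gauss_pos z.2)).ne this

lemma lintegral_stft_mul_stft_le (u : 𝓢(V, ℂ)) (ζ : V × V) :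
    ∫⁻ w : V × V, ‖stft u w.1 (w.2 + ζ.1)‖ₑ * ‖stft u (w.1 + ζ.2) w.2‖ₑ ≤
      2 * ENNReal.ofReal (∫ y, ‖u y‖ ^ 2) := by
  have hc := continuous_stft u
  have hmul : ∀ a b : ENNReal, a * b ≤ a ^ 2 + b ^ 2 := fun a b => by
    rcases le_total a b with h | h
    · calc a * b ≤ b * b := by gcongr
        _ = b ^ 2 := (sq b).symm
        _ ≤ _ := le_add_self
    · calc a * b ≤ a * a := by gcongr
        _ = a ^ 2 := (sq a).symm
        _ ≤ _ := le_self_add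
  have h1 : ∫⁻ w : V × V, ‖stft u w.1 (w.2 + ζ.1)‖ₑ ^ 2 =
      ∫⁻ w : V × V, ‖stft u w.1 w.2‖ₑ ^ 2 := by
    rw [← lintegral_add_right_eq_self (fun w : V × V => ‖stft u w.1 w.2‖ₑ ^ 2) ((0, ζ.1) : V × V)]
    simp
  have h2 : ∫⁻ w : V × V, ‖stft u (w.1 + ζ.2) w.2‖ₑ ^ 2 =
      ∫⁻ w : V × V, ‖stft u w.1 w.2‖ₑ ^ 2 := by
    rw [← lintegral_add_right_eq_self (fun w : V × V => ‖stft u w.1 w.2‖ₑ ^ 2) ((ζ.2, 0) : V × V)]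
    simp
  have hm : Measurable fun w : V × V => ‖stft u w.1 (w.2 + ζ.1)‖ₑ ^ 2 := by
    have : Continuous fun w : V × V => stft u w.1 (w.2 + ζ.1) :=
      hc.comp (by fun_prop : Continuous fun w : V × V => (w.1, w.2 + ζ.1))
    exact (by fun_prop : Continuous fun w : V × V => ‖stft u w.1 (w.2 + ζ.1)‖ₑ ^ 2).measurable
  calc _ ≤ ∫⁻ w : V × V, (‖stft u w.1 (w.2 + ζ.1)‖ₑ ^ 2 + ‖stft u (w.1 + ζ.2) w.2‖ₑ ^ 2) :=
        lintegral_mono fun w => hmul _ _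
    _ = 2 * ∫⁻ w : V × V, ‖stft u w.1 w.2‖ₑ ^ 2 := by
        rw [lintegral_add_left hm, h1, h2, two_mul]
    _ ≤ _ := by
        gcongr
        exact lintegral_norm_sq_stft_le u

lemma enorm_integral_rihaczek_mul_gaussSymbol_le (u : 𝓢(V, ℂ)) {k : V × V → ℂ}
    (hkc : Continuous k) (hk : Integrable k) (w : V × V) :
    ‖∫ z, rihaczek u z * gaussSymbol (z - w) *
        ∫ ζ, k ζ * phase (⟪ζ.1, z.1⟫_ℝ + ⟪ζ.2, z.2⟫_ℝ)‖ₑ ≤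
      ∫⁻ ζ, ‖k ζ‖ₑ * (‖stft u w.1 (w.2 + ζ.1)‖ₑ * ‖stft u (w.1 + ζ.2) w.2‖ₑ) := by
  have hr := continuous_rihaczek u
  have hint : Integrable (Function.uncurry fun z ζ : V × V =>
      rihaczek u z * gaussSymbol (z - w) * (k ζ * phase (⟪ζ.1, z.1⟫_ℝ + ⟪ζ.2, z.2⟫_ℝ)))
      (volume.prod volume) := by
    obtain ⟨c, hc⟩ := exists_norm_rihaczek_le u
    have h1 : Integrable fun z => rihaczek u z * gaussSymbol (z - w) :=
      (integrable_gaussSymbol.comp_sub_right w).bdd_mul hr.aestronglyMeasurable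
        (Filter.Eventually.of_forall hc)
    refine (h1.mul_prod hk).mono (Continuous.aestronglyMeasurable ?_)
      (Filter.Eventually.of_forall fun p => ?_)
    · unfold Function.uncurry
      fun_prop
    · simp [Function.uncurry]
  have heq : ∫ z, rihaczek u z * gaussSymbol (z - w) *
        ∫ ζ, k ζ * phase (⟪ζ.1, z.1⟫_ℝ + ⟪ζ.2, z.2⟫_ℝ) =
      ∫ ζ, k ζ * (phase ⟪ζ.2, w.2⟫_ℝ * conj (stft u w.1 (w.2 + ζ.1)) *
        stft u (w.1 + ζ.2) w.2) := by
    simp_rw [← integral_const_mul]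
    rw [integral_integral_swap hint]
    refine integral_congr_ae (Filter.Eventually.of_forall fun ζ => ?_)
    simp only
    rw [← integral_rihaczek_mul_gaussSymbol, ← integral_const_mul]
    refine integral_congr_ae (Filter.Eventually.of_forall fun z => ?_)
    simp only
    ring
  rw [heq]
  refine (enorm_integral_le_lintegral_enorm _).trans (lintegral_mono fun ζ => ?_)
  rw [enorm_mul, enorm_mul, enorm_mul, ← ofReal_norm (phase _), norm_phase, ENNReal.ofReal_one,
    one_mul, ← ofReal_norm (conj (stft u w.1 (w.2 + ζ.1))), RCLike.norm_conj, ofReal_norm]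

lemma integral_norm_iteratedFDeriv_mul_le {m : V × V → ℂ} (hm : ContDiff ℝ ∞ m)
    (hmc : HasCompactSupport m) (N : ℕ) :
    ∃ c, 0 ≤ c ∧ ∀ B : V × V → ℂ, ContDiff ℝ ∞ B → ∀ M, 0 ≤ M →
      (∀ q ≤ N, ∀ z, ‖iteratedFDeriv ℝ q B z‖ ≤ M) → ∀ w, ∀ q ≤ N,
        ∫ z, ‖iteratedFDeriv ℝ q (fun z => m (z - w) * B z) z‖ ≤ c * M := by
  let S : ℕ → ℝ := fun q => ∑ i ∈ Finset.range (q + 1),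
    (q.choose i : ℝ) * ∫ z, ‖iteratedFDeriv ℝ i m z‖
  have hS : ∀ q, 0 ≤ S q := fun q => Finset.sum_nonneg fun i _ =>
    mul_nonneg (Nat.cast_nonneg _) (integral_nonneg fun z => norm_nonneg _)
  refine ⟨∑ q ∈ Finset.range (N + 1), S q, Finset.sum_nonneg fun q _ => hS q, ?_⟩
  intro B hB M hM hBM w q hq
  have hmi : ∀ i, Integrable fun z => ‖iteratedFDeriv ℝ i m z‖ := fun i =>
    ((hm.continuous_iteratedFDeriv (mod_cast le_top)).integrable_of_hasCompactSupport
      (hmc.iteratedFDeriv i)).norm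
  have hmw : ContDiff ℝ ∞ fun z => m (z - w) := by fun_prop
  calc _ ≤ ∫ z, ∑ i ∈ Finset.range (q + 1),
        (q.choose i : ℝ) * ‖iteratedFDeriv ℝ i m (z - w)‖ * M := by
        refine integral_mono_of_nonneg (Filter.Eventually.of_forall fun z => norm_nonneg _) ?_
          (Filter.Eventually.of_forall fun z => ?_)
        · exact integrable_finsetSum _ fun i _ =>
            (((hmi i).comp_sub_right w).const_mul _).mul_const _
        · refine (norm_iteratedFDeriv_mul_le hmw hB z (mod_cast le_top)).trans
            (Finset.sum_le_sum fun i _ => ?_)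
          rw [iteratedFDeriv_comp_sub]
          gcongr
          exact hBM _ (by omega) z
    _ = S q * M := by
        rw [integral_finsetSum _ fun i _ => (((hmi i).comp_sub_right w).const_mul _).mul_const _,
          Finset.sum_mul]
        refine Finset.sum_congr rfl fun i _ => ?_
        rw [integral_mul_const, integral_const_mul,
          integral_sub_right_eq_self (fun z => ‖iteratedFDeriv ℝ i m z‖) w]
    _ ≤ _ := by
        gcongr
        exact Finset.single_le_sum (f := S) (fun q _ => hS q) (Finset.mem_range.2 (by omega))

lemma lintegral_lintegral_stft_le (u : 𝓢(V, ℂ)) {κ : V × V → ℝ} (hκ : Continuous κ) :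
    ∫⁻ w : V × V, ∫⁻ ζ : V × V, ENNReal.ofReal (κ ζ) *
        (‖stft u w.1 (w.2 + ζ.1)‖ₑ * ‖stft u (w.1 + ζ.2) w.2‖ₑ) ≤
      (∫⁻ ζ, ENNReal.ofReal (κ ζ)) * (2 * ENNReal.ofReal (∫ y, ‖u y‖ ^ 2)) := by
  have hst : Measurable fun z : V × V => ‖stft u z.1 z.2‖ₑ :=
    (continuous_stft u).enorm.measurable
  have f1 : Measurable fun p : (V × V) × (V × V) => (p.1.1, p.1.2 + p.2.1) := by fun_prop
  have f2 : Measurable fun p : (V × V) × (V × V) => (p.1.1 + p.2.2, p.1.2) := by fun_prop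
  have m1 := hst.comp f1
  have m2 := hst.comp f2
  have m3 : Measurable fun ζ : V × V => ENNReal.ofReal (κ ζ) := hκ.measurable.ennreal_ofReal
  have m4 := (m3.comp (measurable_snd (α := V × V) (β := V × V))).mul (m1.mul m2)
  calc _ = ∫⁻ ζ : V × V, ∫⁻ w : V × V, ENNReal.ofReal (κ ζ) *
        (‖stft u w.1 (w.2 + ζ.1)‖ₑ * ‖stft u (w.1 + ζ.2) w.2‖ₑ) :=
        lintegral_lintegral_swap m4.aemeasurable
    _ ≤ ∫⁻ ζ, ENNReal.ofReal (κ ζ) * (2 * ENNReal.ofReal (∫ y, ‖u y‖ ^ 2)) := by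
        refine lintegral_mono fun ζ => ?_
        rw [lintegral_const_mul' _ _ ENNReal.ofReal_ne_top]
        gcongr
        exact lintegral_stft_mul_stft_le u ζ
    _ = _ := lintegral_mul_const _ m3

/-- The Calderón–Vaillancourt theorem for the Rihaczek pairing. -/
lemma exists_norm_integral_rihaczek_mul_le : ∃ C : ℝ, 0 ≤ C ∧ ∃ N : ℕ,
    ∀ B : V × V → ℂ, ContDiff ℝ ∞ B → HasCompactSupport B → ∀ M, 0 ≤ M →
      (∀ q ≤ N, ∀ z, ‖iteratedFDeriv ℝ q B z‖ ≤ M) → ∀ u : 𝓢(V, ℂ),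
        ‖∫ z, rihaczek u z * B z‖ ≤ C * M * ∫ y, ‖u y‖ ^ 2 := by
  obtain ⟨m, hm, hmc, hm0⟩ := exists_cutoff (V := V)
  obtain ⟨N, κ, hκ, hκc, hκ0, hdec⟩ := exists_planeWave_decomposition (V := V)
  obtain ⟨c, hc0, hc⟩ := integral_norm_iteratedFDeriv_mul_le hm hmc N
  set d := ∫ z, gaussSymbol z * m z with hd
  have hκi : 0 ≤ ∫ ζ, κ ζ := integral_nonneg hκ0
  refine ⟨‖d‖⁻¹ * (c * (∫ ζ, κ ζ) * 2), by positivity, N, ?_⟩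
  intro B hB hBc M hM hBM u
  have hE : 0 ≤ ∫ y, ‖u y‖ ^ 2 := integral_nonneg fun y => by positivity
  have hr := continuous_rihaczek u
  have hmcont := hm.continuous
  have hBcont := hB.continuous
  have hFB : Integrable fun z => rihaczek u z * B z :=
    (hr.mul hBcont).integrable_of_hasCompactSupport hBc.mul_left
  have hGm : Integrable fun z => gaussSymbol z * m z :=
    (continuous_gaussSymbol.mul hmcont).integrable_of_hasCompactSupport hmc.mul_left
  have hint : Integrable (Function.uncurry fun w z : V × V =>
      rihaczek u z * B z * (gaussSymbol (z - w) * m (z - w))) (volume.prod volume) := by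
    have := Integrable.convolution_integrand (μ := (volume : Measure (V × V)))
      (ContinuousLinearMap.mul ℝ ℂ) hFB hGm.comp_neg
    refine this.congr (Filter.Eventually.of_forall fun p => ?_)
    simp [Function.uncurry]
  have heq : (∫ z, rihaczek u z * B z) * d =
      ∫ w, ∫ z, rihaczek u z * gaussSymbol (z - w) * (m (z - w) * B z) := by
    calc _ = ∫ z, ∫ w, rihaczek u z * B z * (gaussSymbol (z - w) * m (z - w)) := by
          rw [← integral_mul_const]
          refine integral_congr_ae (Filter.Eventually.of_forall fun z => ?_)
          simp only
          rw [integral_const_mul,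
            integral_sub_left_eq_self (fun w => gaussSymbol w * m w) volume z]
      _ = _ := by
          rw [← integral_integral_swap hint]
          refine integral_congr_ae (Filter.Eventually.of_forall fun w =>
            integral_congr_ae (Filter.Eventually.of_forall fun z => ?_))
          simp only
          ring
  have hw : ∀ w, ‖∫ z, rihaczek u z * gaussSymbol (z - w) * (m (z - w) * B z)‖ₑ ≤
      ∫⁻ ζ, ENNReal.ofReal (c * M * κ ζ) *
        (‖stft u w.1 (w.2 + ζ.1)‖ₑ * ‖stft u (w.1 + ζ.2) w.2‖ₑ) := by
    intro w
    obtain ⟨k, hkc, hk, hkz⟩ := hdec (fun z => m (z - w) * B z) (by fun_prop) hBc.mul_left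
      (c * M) (hc B hB M hM hBM w)
    have hki : Integrable k := (hκ.const_mul (c * M)).mono' hkc.aestronglyMeasurable
      (Filter.Eventually.of_forall hk)
    have := enorm_integral_rihaczek_mul_gaussSymbol_le u hkc hki w
    simp_rw [← hkz] at this
    refine this.trans (lintegral_mono fun ζ => ?_)
    gcongr
    rw [← ofReal_norm]
    exact ENNReal.ofReal_le_ofReal (hk ζ)
  have hmain : ‖(∫ z, rihaczek u z * B z) * d‖ₑ ≤
      ENNReal.ofReal (c * M * (∫ ζ, κ ζ) * (2 * ∫ y, ‖u y‖ ^ 2)) := by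
    rw [heq]
    refine (enorm_integral_le_lintegral_enorm _).trans ((lintegral_mono hw).trans
      ((lintegral_lintegral_stft_le u (hκc.const_mul (c * M))).trans_eq ?_))
    rw [← ofReal_integral_eq_lintegral_ofReal (hκ.const_mul _)
      (Filter.Eventually.of_forall fun ζ => mul_nonneg (by positivity) (hκ0 ζ)),
      integral_const_mul, ENNReal.ofReal_mul (p := c * M * ∫ ζ, κ ζ) (by positivity),
      ENNReal.ofReal_mul (p := 2) zero_le_two]
    simp
  rw [← ofReal_norm, ENNReal.ofReal_le_ofReal_iff (by positivity), norm_mul] at hmain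
  have hdpos : 0 < ‖d‖ := norm_pos_iff.2 hm0
  rw [show ‖d‖⁻¹ * (c * (∫ ζ, κ ζ) * 2) * M * ∫ y, ‖u y‖ ^ 2 =
    (c * M * (∫ ζ, κ ζ) * (2 * ∫ y, ‖u y‖ ^ 2)) / ‖d‖ by field_simp, le_div_iff₀ hdpos]
  exact hmain

lemma exists_integral_gaussSymbol : ∃ c : ℝ, 0 < c ∧ ∫ z : V × V, gaussSymbol z = c := by
  refine ⟨∫ y : V, gauss y * gauss y, ?_, ?_⟩
  · have hi : Integrable fun y : V => gauss y * gauss y :=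
      integrable_gauss.bdd_mul (c := 1) continuous_gauss.aestronglyMeasurable
        (Filter.Eventually.of_forall fun y => by
          rw [Real.norm_eq_abs, abs_of_pos (gauss_pos _)]
          exact gauss_le_one y)
    rw [integral_pos_iff_support_of_nonneg
      (fun y => (mul_pos (gauss_pos y) (gauss_pos y)).le) hi]
    have : Function.support (fun y : V => gauss y * gauss y) = Set.univ :=
      Set.eq_univ_of_forall fun y => (mul_pos (gauss_pos y) (gauss_pos y)).ne'
    rw [this]
    exact Measure.measure_univ_pos.2 (NeZero.ne _)
  · rw [Measure.volume_eq_prod, integral_prod _ integrable_gaussSymbol, ← integral_complex_ofReal]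
    refine integral_congr_ae (Filter.Eventually.of_forall fun y => ?_)
    have h := integral_gauss_mul_phase (-y)
    rw [gauss_neg] at h
    simp only [gaussSymbol, mul_assoc]
    rw [integral_const_mul]
    simp only [inner_neg_left] at h
    rw [h, Complex.ofReal_mul]

lemma integrable_norm_sq_mul_gaussSymbol :
    Integrable fun w : V × V => ‖w‖ ^ 2 * ‖gaussSymbol w‖ := by
  have h2 : Integrable fun y : V => ‖y‖ ^ 2 * gauss y := by
    have h := (integrable_gauss (V := V)).comp_smul (R := (Real.sqrt 2)⁻¹) (by positivity)
    refine h.mono' (by fun_prop) (Filter.Eventually.of_forall fun y => ?_)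
    rw [Real.norm_of_nonneg (mul_nonneg (by positivity) (gauss_pos y).le)]
    have hs : ‖(Real.sqrt 2)⁻¹ • y‖ ^ 2 = ‖y‖ ^ 2 / 2 := by
      rw [norm_smul, mul_pow, norm_inv, inv_pow, Real.norm_of_nonneg (Real.sqrt_nonneg _),
        Real.sq_sqrt zero_le_two]
      ring
    rw [gauss, gauss, hs]
    have h3 : ‖y‖ ^ 2 ≤ Real.exp (Real.pi * (‖y‖ ^ 2 / 2)) := by
      refine le_trans ?_ (Real.add_one_le_exp _)
      nlinarith [Real.pi_gt_three, sq_nonneg ‖y‖]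
    calc _ ≤ Real.exp (Real.pi * (‖y‖ ^ 2 / 2)) * Real.exp (-(Real.pi * ‖y‖ ^ 2)) := by gcongr
      _ = _ := by
        rw [← Real.exp_add]
        congr 1
        ring
  have h1 := integrable_gauss (V := V)
  refine ((h2.mul_prod h1).add (h1.mul_prod h2)).mono' (by fun_prop)
    (Filter.Eventually.of_forall fun w => ?_)
  rw [Real.norm_of_nonneg (by positivity), norm_gaussSymbol]
  have hw : ‖w‖ ^ 2 ≤ ‖w.1‖ ^ 2 + ‖w.2‖ ^ 2 := by
    rw [Prod.norm_def]
    rcases max_cases ‖w.1‖ ‖w.2‖ with h | h <;> rw [h.1] <;> nlinarith [sq_nonneg ‖w.1‖,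
      sq_nonneg ‖w.2‖]
  simp only [Pi.add_apply]
  have := mul_le_mul_of_nonneg_right hw (mul_pos (gauss_pos w.1) (gauss_pos w.2)).le
  linarith

lemma integral_mul_rihaczek_gaussSymbol (u : 𝓢(V, ℂ)) (A : V × V → ℂ) :
    ∫ w, ∫ z, rihaczek u z * A w * gaussSymbol (z - w) =
      ∫ w, A w * ((‖stft u w.1 w.2‖ ^ 2 : ℝ) : ℂ) := by
  refine integral_congr_ae (Filter.Eventually.of_forall fun w => ?_)
  have h := integral_rihaczek_mul_gaussSymbol u w 0
  simp only [Prod.fst_zero, Prod.snd_zero, inner_zero_left, add_zero, phase_zero, mul_one,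
    one_mul] at h
  rw [Complex.conj_mul'] at h
  simp only
  rw [Complex.ofReal_pow, ← h, ← integral_const_mul]
  refine integral_congr_ae (Filter.Eventually.of_forall fun z => ?_)
  simp only
  ring

/-- The average of the second differences of a symbol against the Gaussian symbol measures the
failure of the quantization to be a superposition of projections. -/
lemma integral_rihaczek_second_difference (u : 𝓢(V, ℂ)) {A : V × V → ℂ} (hA : Continuous A)
    (hAc : HasCompactSupport A) :
    ∫ w : V × V, gaussSymbol w * ∫ z, rihaczek u z * (A z - A (z - w) - (A (z + w) - A z)) =
      2 * ((∫ z : V × V, gaussSymbol z) * ∫ z, rihaczek u z * A z) -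
        2 * ∫ w, A w * ((‖stft u w.1 w.2‖ ^ 2 : ℝ) : ℂ) := by
  have hF := integrable_rihaczek u
  have hFc := continuous_rihaczek u
  have hG := integrable_gaussSymbol (V := V)
  have hAi : Integrable A := hA.integrable_of_hasCompactSupport hAc
  obtain ⟨c, hc⟩ := hA.bounded_above_of_compact_support hAc
  have hprod : ∀ T : (V × V) × (V × V) → V × V, Continuous T →
      Integrable (fun p : (V × V) × (V × V) => A (T p) * (gaussSymbol p.1 * rihaczek u p.2))
        (volume.prod volume) := fun T hT =>
    (hG.mul_prod hF).bdd_mul (hA.comp hT).aestronglyMeasurable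
      (Filter.Eventually.of_forall fun p => hc _)
  have i0 := hprod (fun p => p.2) (by fun_prop)
  have i1 := hprod (fun p => p.2 - p.1) (by fun_prop)
  have i2 := hprod (fun p => p.2 + p.1) (by fun_prop)
  have hJ : Integrable (Function.uncurry fun w z : V × V =>
      rihaczek u z * A w * gaussSymbol (z - w)) (volume.prod volume) := by
    have : Continuous fun p : (V × V) × (V × V) => gaussSymbol (p.2 - p.1) := by fun_prop
    refine ((hAi.mul_prod hF).bdd_mul this.aestronglyMeasurable
      (Filter.Eventually.of_forall fun p => norm_gaussSymbol_le_one _)).congr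
      (Filter.Eventually.of_forall fun p => ?_)
    simp only [Function.uncurry]
    ring
  have e0 : ∫ p : (V × V) × (V × V),
      A p.2 * (gaussSymbol p.1 * rihaczek u p.2) ∂(volume.prod volume) =
      (∫ z : V × V, gaussSymbol z) * ∫ z, rihaczek u z * A z := by
    rw [← integral_prod_mul]
    refine integral_congr_ae (Filter.Eventually.of_forall fun p => ?_)
    simp only
    ring
  have e1 : ∫ p : (V × V) × (V × V),
      A (p.2 - p.1) * (gaussSymbol p.1 * rihaczek u p.2) ∂(volume.prod volume) =
      ∫ w, A w * ((‖stft u w.1 w.2‖ ^ 2 : ℝ) : ℂ) := by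
    rw [← integral_mul_rihaczek_gaussSymbol, integral_integral_swap hJ, integral_prod_symm _ i1]
    refine integral_congr_ae (Filter.Eventually.of_forall fun z => ?_)
    simp only
    rw [← integral_sub_left_eq_self (fun w => rihaczek u z * A w * gaussSymbol (z - w)) volume z]
    refine integral_congr_ae (Filter.Eventually.of_forall fun w => ?_)
    simp only [sub_sub_cancel]
    ring
  have e2 : ∫ p : (V × V) × (V × V),
      A (p.2 + p.1) * (gaussSymbol p.1 * rihaczek u p.2) ∂(volume.prod volume) =
      ∫ w, A w * ((‖stft u w.1 w.2‖ ^ 2 : ℝ) : ℂ) := by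
    rw [← e1, integral_prod_symm _ i1, integral_prod_symm _ i2]
    refine integral_congr_ae (Filter.Eventually.of_forall fun z => ?_)
    simp only
    rw [← integral_neg_eq_self (fun w => A (z + w) * (gaussSymbol w * rihaczek u z)) volume]
    simp only [gaussSymbol_neg, sub_eq_add_neg]
  have hall : Integrable (fun p : (V × V) × (V × V) =>
      (A p.2 * (gaussSymbol p.1 * rihaczek u p.2) -
        A (p.2 - p.1) * (gaussSymbol p.1 * rihaczek u p.2)) -
      (A (p.2 + p.1) * (gaussSymbol p.1 * rihaczek u p.2) -
        A p.2 * (gaussSymbol p.1 * rihaczek u p.2))) (volume.prod volume) :=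
    (i0.sub i1).sub (i2.sub i0)
  have hsum := integral_sub (i0.sub i1) (i2.sub i0)
  simp only [Pi.sub_apply] at hsum
  rw [integral_sub i0 i1, integral_sub i2 i0, e0, e1, e2] at hsum
  trans ((∫ z : V × V, gaussSymbol z) * ∫ z, rihaczek u z * A z) -
    (∫ w, A w * ((‖stft u w.1 w.2‖ ^ 2 : ℝ) : ℂ)) -
    ((∫ w, A w * ((‖stft u w.1 w.2‖ ^ 2 : ℝ) : ℂ)) -
      ((∫ z : V × V, gaussSymbol z) * ∫ z, rihaczek u z * A z))
  · rw [← hsum, integral_prod _ hall]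
    refine integral_congr_ae (Filter.Eventually.of_forall fun w => ?_)
    simp only
    rw [← integral_const_mul]
    refine integral_congr_ae (Filter.Eventually.of_forall fun z => ?_)
    simp only
    ring
  · ring

/-- The sharp Gårding inequality for the Rihaczek pairing, with a constant depending only on the
derivatives of order at least two of the symbol. -/
lemma exists_le_re_integral_rihaczek_mul : ∃ C : ℝ, 0 ≤ C ∧ ∃ N : ℕ,
    ∀ A : V × V → ℂ, ContDiff ℝ ∞ A → HasCompactSupport A → ∀ M, 0 ≤ M →
      (∀ q, 2 ≤ q → q ≤ N → ∀ z, ‖iteratedFDeriv ℝ q A z‖ ≤ M) → (∀ z, 0 ≤ (A z).re) →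
        ∀ u : 𝓢(V, ℂ), -(C * M * ∫ y, ‖u y‖ ^ 2) ≤ (∫ z, rihaczek u z * A z).re := by
  obtain ⟨C, hC, N, hCV⟩ := exists_norm_integral_rihaczek_mul_le (V := V)
  obtain ⟨c, hc, hcG⟩ := exists_integral_gaussSymbol (V := V)
  set S := ∫ w : V × V, ‖w‖ ^ 2 * ‖gaussSymbol w‖ with hS
  have hS0 : 0 ≤ S := integral_nonneg fun w => by positivity
  refine ⟨C * S / (2 * c), by positivity, N + 2, ?_⟩
  intro A hA hAc M hM hAM hre u
  have hE : 0 ≤ ∫ y, ‖u y‖ ^ 2 := integral_nonneg fun y => by positivity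
  have hAcont := hA.continuous
  have hB : ∀ w, ‖∫ z, rihaczek u z * (A z - A (z - w) - (A (z + w) - A z))‖ ≤
      C * (M * ‖w‖ * ‖w‖) * ∫ y, ‖u y‖ ^ 2 := by
    intro w
    have hφ : ContDiff ℝ ∞ fun z => A (z + w) - A z := by fun_prop
    refine hCV _ (by fun_prop) ?_ _ (by positivity) (fun q hq z => ?_) u
    · have h1 : HasCompactSupport fun z => A (z - w) :=
        hAc.comp_homeomorph (Homeomorph.subRight w)
      have h2 : HasCompactSupport fun z => A (z + w) :=
        hAc.comp_homeomorph (Homeomorph.addRight w)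
      exact (hAc.sub h1).sub (h2.sub hAc)
    · have h1 : ∀ z, ‖iteratedFDeriv ℝ (q + 1) (fun z => A (z + w) - A z) z‖ ≤ M * ‖w‖ :=
        norm_iteratedFDeriv_translate_sub_le hA (hAM (q + 1 + 1) (by omega) (by omega)) w
      have h2 := norm_iteratedFDeriv_translate_sub_le hφ h1 (-w) z
      rw [norm_neg] at h2
      refine le_trans (le_of_eq ?_) h2
      simp only [neg_add_cancel_right, sub_eq_add_neg]
  have hnorm : ‖∫ w, gaussSymbol w * ∫ z, rihaczek u z * (A z - A (z - w) - (A (z + w) - A z))‖ ≤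
      C * M * (∫ y, ‖u y‖ ^ 2) * S := by
    rw [hS, ← integral_const_mul]
    refine norm_integral_le_of_norm_le (integrable_norm_sq_mul_gaussSymbol.const_mul _)
      (Filter.Eventually.of_forall fun w => ?_)
    rw [norm_mul]
    calc _ ≤ ‖gaussSymbol w‖ * (C * (M * ‖w‖ * ‖w‖) * ∫ y, ‖u y‖ ^ 2) := by
          gcongr
          exact hB w
      _ = _ := by ring
  have hpos : 0 ≤ (∫ w, A w * ((‖stft u w.1 w.2‖ ^ 2 : ℝ) : ℂ)).re := by
    have hst := continuous_stft u
    have hi : Integrable fun w => A w * ((‖stft u w.1 w.2‖ ^ 2 : ℝ) : ℂ) :=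
      (hAcont.mul (by fun_prop)).integrable_of_hasCompactSupport hAc.mul_right
    rw [← RCLike.re_eq_complex_re, ← integral_re hi]
    refine integral_nonneg fun w => ?_
    simp only [RCLike.re_eq_complex_re, Complex.re_mul_ofReal]
    exact mul_nonneg (hre w) (by positivity)
  rw [integral_rihaczek_second_difference u hAcont hAc, hcG] at hnorm
  have h := (abs_le.1 ((Complex.abs_re_le_norm _).trans hnorm)).1
  simp only [Complex.sub_re, ← Complex.ofReal_ofNat, Complex.re_ofReal_mul] at h
  rw [show C * S / (2 * c) * M * ∫ y, ‖u y‖ ^ 2 = C * M * (∫ y, ‖u y‖ ^ 2) * S / (2 * c) by ring,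
    ← neg_div, div_le_iff₀ (by positivity)]
  linarith

end PhaseSpace

section Coordinates

variable {n : ℕ}

lemma pderivs_cons (i : Fin n ⊕ Fin n) (l : List (Fin n ⊕ Fin n))
    (f : ((Fin n → ℝ) × (Fin n → ℝ)) → ℂ) : pderivs (i :: l) f = pderiv1 i (pderivs l f) := rfl

lemma pderivs_append_singleton (i : Fin n ⊕ Fin n) (l : List (Fin n ⊕ Fin n))
    (f : ((Fin n → ℝ) × (Fin n → ℝ)) → ℂ) :
    pderivs (l ++ [i]) f = pderivs l (pderiv1 i f) := by
  simp [pderivs]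

lemma contDiff_pderiv1 {f : ((Fin n → ℝ) × (Fin n → ℝ)) → ℂ} (hf : ContDiff ℝ ∞ f)
    (i : Fin n ⊕ Fin n) : ContDiff ℝ ∞ (pderiv1 i f) :=
  (hf.fderiv_right (by simp)).clm_apply contDiff_const

lemma contDiff_pderivs {f : ((Fin n → ℝ) × (Fin n → ℝ)) → ℂ} (hf : ContDiff ℝ ∞ f)
    (l : List (Fin n ⊕ Fin n)) : ContDiff ℝ ∞ (pderivs l f) := by
  induction l with
  | nil => exact hf
  | cons i l ih => exact contDiff_pderiv1 ih i

/-- The coordinate functionals dual to the directions used in `pderiv1`. -/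
noncomputable def coordinate (i : Fin n ⊕ Fin n) : ((Fin n → ℝ) × (Fin n → ℝ)) →L[ℝ] ℝ :=
  Sum.elim
    (fun j => (ContinuousLinearMap.proj j).comp (ContinuousLinearMap.fst ℝ _ _))
    (fun j => (ContinuousLinearMap.proj j).comp (ContinuousLinearMap.snd ℝ _ _)) i

lemma fderiv_eq_sum_pderiv1 (f : ((Fin n → ℝ) × (Fin n → ℝ)) → ℂ)
    (p : (Fin n → ℝ) × (Fin n → ℝ)) :
    fderiv ℝ f p = ∑ i, (coordinate i).smulRight (pderiv1 i f p) := by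
  refine ContinuousLinearMap.ext fun v => ?_
  have hv : v = ∑ i : Fin n ⊕ Fin n, coordinate i v •
      (Sum.elim (fun j => (Pi.single j 1, 0)) (fun j => (0, Pi.single j 1)) i :
        (Fin n → ℝ) × (Fin n → ℝ)) := by
    ext j <;> simp [coordinate, Prod.fst_sum, Prod.snd_sum, Finset.sum_apply, Pi.single_apply]
  conv_lhs => rw [hv, map_sum]
  rw [_root_.sum_apply]
  refine Finset.sum_congr rfl fun i _ => ?_
  rw [map_smul, ContinuousLinearMap.smulRight_apply, pderiv1]

/-- Bounds on all coordinate partial derivatives of order `k` bound the `k`-th derivative. -/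
lemma exists_norm_iteratedFDeriv_le_of_pderivs (k : ℕ) : ∃ c : ℝ, 0 ≤ c ∧
    ∀ f : ((Fin n → ℝ) × (Fin n → ℝ)) → ℂ, ContDiff ℝ ∞ f → ∀ M, 0 ≤ M →
      (∀ l : List (Fin n ⊕ Fin n), l.length = k → ∀ p, ‖pderivs l f p‖ ≤ M) →
        ∀ p, ‖iteratedFDeriv ℝ k f p‖ ≤ c * M := by
  induction k with
  | zero =>
    refine ⟨1, zero_le_one, fun f _ M _ h p => ?_⟩
    rw [norm_iteratedFDeriv_zero, one_mul]
    exact h [] rfl p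
  | succ k ih =>
    obtain ⟨c, hc, ih⟩ := ih
    let T : (i : Fin n ⊕ Fin n) → ℂ →L[ℝ] ((Fin n → ℝ) × (Fin n → ℝ)) →L[ℝ] ℂ := fun i =>
      ContinuousLinearMap.smulRightL ℝ ((Fin n → ℝ) × (Fin n → ℝ)) ℂ (coordinate i)
    refine ⟨∑ i, ‖T i‖ * c, Finset.sum_nonneg fun i _ => by positivity, fun f hf M hM h p => ?_⟩
    have hd : fderiv ℝ f = fun p => ∑ i, (T i ∘ pderiv1 i f) p := by
      ext1 p
      exact fderiv_eq_sum_pderiv1 f p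
    have hT : ∀ i, ContDiff ℝ ∞ (T i ∘ pderiv1 i f) := fun i =>
      (T i).contDiff.comp (contDiff_pderiv1 hf i)
    rw [← norm_iteratedFDeriv_fderiv, hd, iteratedFDeriv_fun_sum_apply
      (fun i _ => ((hT i).of_le (mod_cast le_top)).contDiffAt), Finset.sum_mul]
    refine (norm_sum_le _ _).trans (Finset.sum_le_sum fun i _ => ?_)
    refine ((T i).norm_iteratedFDeriv_comp_left
      (contDiff_pderiv1 hf i).contDiffAt (mod_cast le_top)).trans ?_
    rw [mul_assoc]
    gcongr
    refine ih _ (contDiff_pderiv1 hf i) M hM (fun l hl p => ?_) p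
    rw [← pderivs_append_singleton]
    exact h _ (by simp [hl]) p

lemma pderivs_comp_smul {f : ((Fin n → ℝ) × (Fin n → ℝ)) → ℂ} (hf : ContDiff ℝ ∞ f) (s t : ℝ)
    (l : List (Fin n ⊕ Fin n)) (p : (Fin n → ℝ) × (Fin n → ℝ)) :
    pderivs l (fun p => f (s • p.1, t • p.2)) p =
      ((s ^ l.countP Sum.isLeft * t ^ l.countP Sum.isRight : ℝ) : ℂ) *
        pderivs l f (s • p.1, t • p.2) := by
  induction l generalizing p with
  | nil => simp [pderivs]
  | cons i l ih =>
    rw [pderivs_cons, pderivs_cons, funext ih]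
    have hg : DifferentiableAt ℝ (pderivs l f) (s • p.1, t • p.2) :=
      (contDiff_pderivs hf l).differentiable (by simp) _
    let S : ((Fin n → ℝ) × (Fin n → ℝ)) →L[ℝ] (Fin n → ℝ) × (Fin n → ℝ) :=
      (s • ContinuousLinearMap.fst ℝ _ _).prod (t • ContinuousLinearMap.snd ℝ _ _)
    have h1 : HasFDerivAt (fun p : (Fin n → ℝ) × (Fin n → ℝ) => pderivs l f (s • p.1, t • p.2))
        ((fderiv ℝ (pderivs l f) (s • p.1, t • p.2)).comp S) p :=
      HasFDerivAt.comp p (g := pderivs l f) (f := S) hg.hasFDerivAt S.hasFDerivAt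
    rw [pderiv1, (h1.const_mul _).fderiv, pderiv1]
    rcases i with j | j
    · have hS : S (Pi.single j 1, 0) = s • ((Pi.single j 1, 0) : (Fin n → ℝ) × (Fin n → ℝ)) := by
        simp [S]
      rw [List.countP_cons_of_pos (by rfl), List.countP_cons_of_neg (by simp)]
      simp only [_root_.smul_apply, ContinuousLinearMap.comp_apply, Sum.elim_inl, hS,
        map_smul, smul_eq_mul, Complex.real_smul, pow_succ]
      push_cast
      ring
    · have hS : S (0, Pi.single j 1) = t • ((0, Pi.single j 1) : (Fin n → ℝ) × (Fin n → ℝ)) := by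
        simp [S]
      rw [List.countP_cons_of_neg (by simp), List.countP_cons_of_pos (by rfl)]
      simp only [_root_.smul_apply, ContinuousLinearMap.comp_apply, Sum.elim_inr, hS,
        map_smul, smul_eq_mul, Complex.real_smul, pow_succ]
      push_cast
      ring

lemma exists_norm_iteratedFDeriv_comp_clm_le_of_pderivs (N : ℕ) {F : Type*} [NormedAddCommGroup F]
    [NormedSpace ℝ F] (g : F →L[ℝ] (Fin n → ℝ) × (Fin n → ℝ)) : ∃ c : ℝ, 0 ≤ c ∧
    ∀ f : ((Fin n → ℝ) × (Fin n → ℝ)) → ℂ, ContDiff ℝ ∞ f → ∀ M, 0 ≤ M → ∀ k ≤ N,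
      (∀ l : List (Fin n ⊕ Fin n), l.length = k → ∀ p, ‖pderivs l f p‖ ≤ M) →
        ∀ p, ‖iteratedFDeriv ℝ k (f ∘ g) p‖ ≤ c * M := by
  choose c hc hcb using exists_norm_iteratedFDeriv_le_of_pderivs (n := n)
  refine ⟨∑ k ∈ Finset.range (N + 1), c k * ‖g‖ ^ k,
    Finset.sum_nonneg fun k _ => mul_nonneg (hc k) (by positivity), ?_⟩
  intro f hf M hM k hk h p
  rw [g.iteratedFDeriv_comp_right hf p (mod_cast le_top)]
  refine (ContinuousMultilinearMap.norm_compContinuousLinearMap_le _ _).trans ?_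
  rw [Finset.prod_const, Finset.card_univ, Fintype.card_fin]
  calc _ ≤ c k * M * ‖g‖ ^ k := by
        gcongr
        exact hcb k f hf M hM h _
    _ = c k * ‖g‖ ^ k * M := by ring
    _ ≤ _ := by
        gcongr
        exact Finset.single_le_sum (f := fun k => c k * ‖g‖ ^ k)
          (fun k _ => mul_nonneg (hc k) (by positivity)) (Finset.mem_range.2 (by omega))

lemma integral_comp_ofLp {G : Type*} [NormedAddCommGroup G] [NormedSpace ℝ G]
    (f : (Fin n → ℝ) → G) : ∫ x : EuclideanSpace ℝ (Fin n), f x.ofLp = ∫ y, f y :=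
  (PiLp.volume_preserving_ofLp (Fin n)).integral_comp
    (EuclideanSpace.equiv (Fin n) ℝ).toHomeomorph.measurableEmbedding f

/-- The sharp Gårding inequality at unit scale, in coordinates. -/
lemma exists_le_re_integral_of_pderivs : ∃ C : ℝ, 0 ≤ C ∧ ∃ N : ℕ,
    ∀ b : ((Fin n → ℝ) × (Fin n → ℝ)) → ℂ, ContDiff ℝ ∞ b → HasCompactSupport b →
      ∀ M, 0 ≤ M → (∀ l : List (Fin n ⊕ Fin n), 2 ≤ l.length → l.length ≤ N →
        ∀ p, ‖pderivs l b p‖ ≤ M) → (∀ p, 0 ≤ (b p).re) → ∀ v : 𝓢(Fin n → ℝ, ℂ),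
          -(C * M * ∫ y, ‖v y‖ ^ 2) ≤ (∫ y : Fin n → ℝ, ∫ η : Fin n → ℝ,
            conj (v y) * (∫ y' : Fin n → ℝ, v y' * phase (-(∑ i, y' i * η i))) *
              phase (∑ i, y i * η i) * b (y, η)).re := by
  obtain ⟨C, hC, N, hCN⟩ :=
    exists_le_re_integral_rihaczek_mul (V := EuclideanSpace ℝ (Fin n))
  let e := EuclideanSpace.equiv (Fin n) ℝ
  let g : (EuclideanSpace ℝ (Fin n) × EuclideanSpace ℝ (Fin n)) ≃L[ℝ]
    (Fin n → ℝ) × (Fin n → ℝ) := e.prodCongr e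
  obtain ⟨c, hc, hcb⟩ := exists_norm_iteratedFDeriv_comp_clm_le_of_pderivs N g.toContinuousLinearMap
  refine ⟨C * c, by positivity, N, fun b hb hbc M hM hbM hre v => ?_⟩
  let w : 𝓢(EuclideanSpace ℝ (Fin n), ℂ) := SchwartzMap.compCLMOfContinuousLinearEquiv ℂ e v
  have hw : ∀ x, w x = v x.ofLp := fun x => rfl
  have hA : ContDiff ℝ ∞ (b ∘ g) := hb.comp g.contDiff
  have hAc : HasCompactSupport (b ∘ g) := hbc.comp_homeomorph g.toHomeomorph
  have key := hCN (b ∘ g) hA hAc (c * M) (by positivity)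
    (fun q hq hqN => hcb b hb M hM q hqN fun l hl => hbM l (by omega) (by omega))
    (fun z => hre _) w
  have hinner : ∀ x y : EuclideanSpace ℝ (Fin n), ⟪x, y⟫_ℝ = ∑ i, x.ofLp i * y.ofLp i := by
    intro x y
    rw [PiLp.inner_apply]
    refine Finset.sum_congr rfl fun i _ => ?_
    simp [mul_comm]
  have hF : ∀ ξ : EuclideanSpace ℝ (Fin n), 𝓕 w ξ =
      ∫ y' : Fin n → ℝ, v y' * phase (-(∑ i, y' i * ξ.ofLp i)) := by
    intro ξ
    rw [← integral_comp_ofLp, SchwartzMap.fourier_coe, fourier_eq_phase]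
    refine integral_congr_ae (Filter.Eventually.of_forall fun x => ?_)
    simp only [hinner, hw]
  have hint : Integrable fun z => rihaczek w z * (b ∘ g) z :=
    ((continuous_rihaczek w).mul hA.continuous).integrable_of_hasCompactSupport hAc.mul_left
  have hI : ∫ z, rihaczek w z * (b ∘ g) z = ∫ y : Fin n → ℝ, ∫ η : Fin n → ℝ,
      conj (v y) * (∫ y' : Fin n → ℝ, v y' * phase (-(∑ i, y' i * η i))) *
        phase (∑ i, y i * η i) * b (y, η) := by
    rw [Measure.volume_eq_prod] at hint ⊢
    rw [integral_prod _ hint, ← integral_comp_ofLp]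
    refine integral_congr_ae (Filter.Eventually.of_forall fun x => ?_)
    simp only
    rw [← integral_comp_ofLp]
    refine integral_congr_ae (Filter.Eventually.of_forall fun ξ => ?_)
    simp only [rihaczek, hw, hinner]
    rw [← hF ξ]
    rfl
  have hn : ∫ x, ‖w x‖ ^ 2 = ∫ y, ‖v y‖ ^ 2 := integral_comp_ofLp fun y => ‖v y‖ ^ 2
  rw [hI, hn] at key
  linarith

lemma integral_eq_pow_smul_integral_comp_smul {G : Type*} [NormedAddCommGroup G]
    [NormedSpace ℝ G] (f : (Fin n → ℝ) → G) {s : ℝ} (hs : 0 < s) :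
    ∫ y, f y = s ^ n • ∫ y, f (s • y) := by
  rw [Measure.integral_comp_smul, smul_smul, Module.finrank_fin_fun,
    abs_of_pos (by positivity), mul_inv_cancel₀ (by positivity), one_smul]

/-- Rescaling turns the quadratic form of the semiclassical quantization into the one at unit
scale. -/
lemma integral_conj_mul_stdOp {h s t : ℝ} (hh : 0 < h) (hs : 0 < s) (ht : 0 < t)
    (hst : s * t = 2 * Real.pi * h) (a : ((Fin n → ℝ) × (Fin n → ℝ)) → ℂ)
    (u : (Fin n → ℝ) → ℂ) :
    ∫ y, conj (u y) * stdOp h a u y = s ^ n • ∫ y : Fin n → ℝ, ∫ η : Fin n → ℝ,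
      conj (u (s • y)) * (∫ y' : Fin n → ℝ, u (s • y') * phase (-(∑ i, y' i * η i))) *
        phase (∑ i, y i * η i) * a (s • y, t • η) := by
  rw [integral_eq_pow_smul_integral_comp_smul _ hs]
  congr 1
  refine integral_congr_ae (Filter.Eventually.of_forall fun y => ?_)
  simp only [stdOp]
  rw [integral_eq_pow_smul_integral_comp_smul _ ht, smul_smul, mul_smul_comm,
    ← integral_const_mul, ← integral_smul]
  refine integral_congr_ae (Filter.Eventually.of_forall fun η => ?_)
  simp only
  rw [integral_eq_pow_smul_integral_comp_smul _ hs, mul_smul_comm, smul_smul, ← hst,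
    mul_pow, show (s ^ n * t ^ n)⁻¹ * t ^ n * s ^ n = 1 by field_simp, one_smul,
    ← integral_const_mul, ← integral_const_mul, ← integral_mul_const, ← integral_mul_const]
  refine integral_congr_ae (Filter.Eventually.of_forall fun y' => ?_)
  have hphase : Complex.exp (Complex.I *
      ((∑ i, ((s • y) i - (s • y') i) * (t • η) i : ℝ) : ℂ) / (h : ℂ)) =
      phase (-(∑ i, y' i * η i)) * phase (∑ i, y i * η i) := by
    rw [← phase_add, phase]
    congr 1
    have hsum : ∑ i, ((s • y) i - (s • y') i) * (t • η) i =
        2 * Real.pi * h * (-(∑ i, y' i * η i) + ∑ i, y i * η i) := by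
      rw [← hst, ← Finset.sum_neg_distrib, ← Finset.sum_add_distrib, Finset.mul_sum]
      refine Finset.sum_congr rfl fun i _ => ?_
      simp only [Pi.smul_apply, smul_eq_mul]
      ring
    rw [hsum]
    have hh' : (h : ℂ) ≠ 0 := mod_cast hh.ne'
    rw [div_eq_iff hh']
    push_cast
    ring
  simp only [hphase]
  ring

lemma countP_isLeft_add_countP_isRight {α β : Type*} (l : List (α ⊕ β)) :
    l.countP Sum.isLeft + l.countP Sum.isRight = l.length := by
  induction l with
  | nil => rfl
  | cons i l ih => rcases i with i | i <;> simp [List.countP_cons] <;> omega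

lemma rescaled_symbol_bound {ρ ρ' h : ℝ} (hρρ' : ρ + ρ' < 1) (hh : h ∈ Set.Ioc (0 : ℝ) 1)
    {i j : ℕ} (hij : 2 ≤ i + j) :
    (2 * Real.pi * h ^ ((1 + ρ - ρ') / 2)) ^ i * (h ^ ((1 - ρ + ρ') / 2)) ^ j *
      h ^ (-(ρ * i + ρ' * j)) ≤ (2 * Real.pi) ^ (i + j) * h ^ (1 - ρ - ρ') := by
  obtain ⟨h0, h1⟩ := hh
  have hpi : 1 ≤ 2 * Real.pi := by linarith [Real.pi_gt_three]
  have hij' : (2 : ℝ) ≤ i + j := mod_cast hij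
  rw [mul_pow, ← Real.rpow_mul_natCast h0.le, ← Real.rpow_mul_natCast h0.le, mul_assoc, mul_assoc,
    ← Real.rpow_add h0, ← Real.rpow_add h0]
  refine mul_le_mul (pow_le_pow_right₀ hpi (by omega))
    (Real.rpow_le_rpow_of_exponent_ge h0 h1 ?_) (by positivity) (by positivity)
  nlinarith [mul_nonneg (sub_nonneg.2 hij') (sub_nonneg.2 hρρ'.le)]

end Coordinates

end GardingModel

open GardingModel

/-- **Sharp Gårding inequality for the model anisotropic calculus**
(Lemma A.2 of the paper).  Let `0 ≤ ρ < 1`, `0 ≤ ρ' ≤ ρ/2`, `ρ + ρ' < 1`,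
`K ⊆ ℝⁿ × ℝⁿ` compact, and seminorm constants `C l > 0` be given.  Then there is
`C₀ > 0` such that for every `h ∈ (0,1]`, every smooth symbol `a` supported in `K`
with `sup ‖∂_y^α ∂_η^β a‖ ≤ C_{αβ} h^{-ρ|α| - ρ'|β|}` and `Re a ≥ 0`, and every
Schwartz function `u`:
`Re ⟨Op_h(a) u, u⟩_{L²} ≥ -C₀ h^{1-ρ-ρ'} ‖u‖²_{L²}`. -/
theorem sharp_garding_model
    (n : ℕ) (hn : 1 ≤ n) (ρ ρ' : ℝ)
    (hρ0 : 0 ≤ ρ) (hρ1 : ρ < 1) (hρ'0 : 0 ≤ ρ') (hρ' : ρ' ≤ ρ / 2)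
    (hρρ' : ρ + ρ' < 1)
    (K : Set ((Fin n → ℝ) × (Fin n → ℝ))) (hK : IsCompact K)
    (C : List (Fin n ⊕ Fin n) → ℝ) (hCpos : ∀ l, 0 < C l) :
    ∃ C₀ > 0, ∀ h : ℝ, h ∈ Set.Ioc (0:ℝ) 1 →
      ∀ a : ((Fin n → ℝ) × (Fin n → ℝ)) → ℂ,
        ContDiff ℝ (⊤ : ℕ∞) a → tsupport a ⊆ K →
        (∀ (l : List (Fin n ⊕ Fin n)) p,
          ‖pderivs l a p‖ ≤
            C l * h ^ (-(ρ * (l.countP Sum.isLeft : ℕ)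
              + ρ' * (l.countP Sum.isRight : ℕ)))) →
        (∀ p, 0 ≤ (a p).re) →
        ∀ u : SchwartzMap (Fin n → ℝ) ℂ,
          (∫ y : Fin n → ℝ, (starRingEnd ℂ) (u y) * stdOp h a (fun z => u z) y).re
            ≥ -C₀ * h ^ (1 - ρ - ρ') * ∫ y : Fin n → ℝ, ‖u y‖ ^ 2 := by
  obtain ⟨C', hC', N, hN⟩ := exists_le_re_integral_of_pderivs (n := n)
  obtain ⟨c, hc⟩ := ((List.finite_length_le (Fin n ⊕ Fin n) N).image
    fun l => (2 * Real.pi) ^ l.length * C l).bddAbove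
  have hcl : ∀ l : List (Fin n ⊕ Fin n), l.length ≤ N → (2 * Real.pi) ^ l.length * C l ≤ c :=
    fun l hl => hc ⟨l, hl, rfl⟩
  have hc0 : 0 ≤ c := by
    refine le_trans ?_ (hcl [] (Nat.zero_le _))
    have := (hCpos []).le
    positivity
  refine ⟨C' * c + 1, by positivity, fun h hh a ha haK hab hre u => ?_⟩
  have h0 : 0 < h := hh.1
  set s : ℝ := 2 * Real.pi * h ^ ((1 + ρ - ρ') / 2) with hs
  set t : ℝ := h ^ ((1 - ρ + ρ') / 2) with ht
  have hs0 : 0 < s := by positivity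
  have ht0 : 0 < t := by positivity
  have hst : s * t = 2 * Real.pi * h := by
    rw [hs, ht, mul_assoc, ← Real.rpow_add h0,
      show (1 + ρ - ρ') / 2 + (1 - ρ + ρ') / 2 = 1 by ring, Real.rpow_one]
  have hac : HasCompactSupport a := hK.of_isClosed_subset (isClosed_tsupport a) haK
  have hbc : HasCompactSupport
      fun p : (Fin n → ℝ) × (Fin n → ℝ) => a (s • p.1, t • p.2) :=
    hac.comp_homeomorph ((Homeomorph.smulOfNeZero s hs0.ne').prodCongr
      (Homeomorph.smulOfNeZero t ht0.ne'))
  have hb : ContDiff ℝ (⊤ : ℕ∞) fun p : (Fin n → ℝ) × (Fin n → ℝ) => a (s • p.1, t • p.2) :=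
    ha.comp ((contDiff_fst.const_smul s).prodMk (contDiff_snd.const_smul t))
  have hbound : ∀ l : List (Fin n ⊕ Fin n), 2 ≤ l.length → l.length ≤ N → ∀ p,
      ‖pderivs l (fun p => a (s • p.1, t • p.2)) p‖ ≤ c * h ^ (1 - ρ - ρ') := by
    intro l hl hlN p
    have hlen := countP_isLeft_add_countP_isRight l
    have hscale := rescaled_symbol_bound hρρ' hh (hl.trans_eq hlen.symm)
    rw [hlen] at hscale
    have hCl := (hCpos l).le
    rw [pderivs_comp_smul ha, norm_mul, Complex.norm_real, Real.norm_of_nonneg (by positivity)]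
    calc _ ≤ s ^ l.countP Sum.isLeft * t ^ l.countP Sum.isRight * (C l *
          h ^ (-(ρ * (l.countP Sum.isLeft : ℕ) + ρ' * (l.countP Sum.isRight : ℕ)))) := by
          gcongr
          exact hab l _
      _ = (s ^ l.countP Sum.isLeft * t ^ l.countP Sum.isRight *
          h ^ (-(ρ * (l.countP Sum.isLeft : ℕ) + ρ' * (l.countP Sum.isRight : ℕ)))) * C l := by
          ring
      _ ≤ ((2 * Real.pi) ^ l.length * h ^ (1 - ρ - ρ')) * C l :=
          mul_le_mul_of_nonneg_right hscale hCl
      _ = ((2 * Real.pi) ^ l.length * C l) * h ^ (1 - ρ - ρ') := by ring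
      _ ≤ _ := by
          gcongr
          exact hcl l hlN
  let v : SchwartzMap (Fin n → ℝ) ℂ := SchwartzMap.compCLMOfContinuousLinearEquiv ℂ
    (ContinuousLinearEquiv.smulLeft (Units.mk0 s hs0.ne')) u
  have hv : ∀ y, v y = u (s • y) := fun y => rfl
  have key := hN _ hb hbc (c * h ^ (1 - ρ - ρ')) (by positivity) hbound (fun p => hre _) v
  simp only [hv] at key
  rw [integral_conj_mul_stdOp h0 hs0 ht0 hst,
    integral_eq_pow_smul_integral_comp_smul (fun y => ‖u y‖ ^ 2) hs0, Complex.smul_re,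
    smul_eq_mul, smul_eq_mul]
  have hE : 0 ≤ h ^ (1 - ρ - ρ') * ∫ y : Fin n → ℝ, ‖u (s • y)‖ ^ 2 :=
    mul_nonneg (by positivity) (integral_nonneg fun y => by positivity)
  rw [ge_iff_le, ← mul_assoc, mul_comm _ (s ^ n), mul_assoc]
  gcongr
  nlinarith [key, hE]
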